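/- Let T = [A,B,C]_R with A ∈ F^{I×R}, B ∈ F^{J×R}, C ∈ F^{K×R}. If k_A + r_B + r_C ≥ 2R + 2, r_A + k_B + r_C ≥ 2R + 2, and r_A + r_B + k_C ≥ 2R + 2, then r_T = R and the CPD of T is unique. -/

import Mathlib

open scoped Matrix
open MeasureTheory

variable {F : Type*} [RCLike F]

/-- The k-rank of a matrix: the largest `k` such that every subset of `k` columns is
linearly independent. -/
noncomputable def krank {I R : ℕ} (A : Matrix (Fin I) (Fin R) F) : ℕ :=
  sSup {k | k ≤ R ∧ ∀ s : Finset (Fin R), s.card = k →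
    LinearIndependent F (fun r : {x // x ∈ s} => A.transpose r.1)}

/-- The tensor `[A,B,C]_R` with entries `t_{ijk} = ∑ r, a_r(i) b_r(j) c_r(k)`. -/
def pdTensor {I J K R : ℕ} (A : Matrix (Fin I) (Fin R) F) (B : Matrix (Fin J) (Fin R) F)
    (C : Matrix (Fin K) (Fin R) F) : Fin I → Fin J → Fin K → F :=
  fun i j k => ∑ r, A i r * B j r * C k r

/-- `T = [A,B,C]_R` is a polyadic decomposition of `T` (columns are required nonzero). -/
def IsPD {I J K R : ℕ} (T : Fin I → Fin J → Fin K → F) (A : Matrix (Fin I) (Fin R) F)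
    (B : Matrix (Fin J) (Fin R) F) (C : Matrix (Fin K) (Fin R) F) : Prop :=
  (∀ r, A.transpose r ≠ 0) ∧ (∀ r, B.transpose r ≠ 0) ∧ (∀ r, C.transpose r ≠ 0) ∧
    T = pdTensor A B C

/-- The rank of a tensor: the minimal number of rank-1 terms in a PD. -/
noncomputable def tensorRank {I J K : ℕ} (T : Fin I → Fin J → Fin K → F) : ℕ :=
  sInf {R | ∃ A : Matrix (Fin I) (Fin R) F, ∃ B : Matrix (Fin J) (Fin R) F,
    ∃ C : Matrix (Fin K) (Fin R) F, IsPD T A B C}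

/-- The CPD of `T` (with `R` terms) is (essentially) unique: any two PDs with `R` terms
coincide up to permutation and scaling. -/
def CPDUnique {I J K : ℕ} (T : Fin I → Fin J → Fin K → F) (R : ℕ) : Prop :=
  ∀ (A A' : Matrix (Fin I) (Fin R) F) (B B' : Matrix (Fin J) (Fin R) F)
    (C C' : Matrix (Fin K) (Fin R) F), IsPD T A B C → IsPD T A' B' C' →
    ∃ σ : Equiv.Perm (Fin R), ∃ la lb lc : Fin R → F,
      (∀ r, la r * lb r * lc r = 1) ∧
      (∀ i r, A' i r = A i (σ r) * la r) ∧
      (∀ j r, B' j r = B j (σ r) * lb r) ∧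
      (∀ k r, C' k r = C k (σ r) * lc r)

/-- The third factor matrix of `T` (with `R` terms) is (essentially) unique. -/
def ThirdFactorUnique {I J K : ℕ} (T : Fin I → Fin J → Fin K → F) (R : ℕ) : Prop :=
  ∀ (A A' : Matrix (Fin I) (Fin R) F) (B B' : Matrix (Fin J) (Fin R) F)
    (C C' : Matrix (Fin K) (Fin R) F), IsPD T A B C → IsPD T A' B' C' →
    ∃ σ : Equiv.Perm (Fin R), ∃ lc : Fin R → F, (∀ r, lc r ≠ 0) ∧
      (∀ k r, C' k r = C k (σ r) * lc r)

/-- The `m`-th compound matrix: the matrix of all `m × m` minors of `A`, with rows and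
columns indexed by the `m`-element index subsets (taken in increasing order). -/
noncomputable def compound {I R : ℕ} (m : ℕ) (A : Matrix (Fin I) (Fin R) F) :
    Matrix {s : Finset (Fin I) // s.card = m} {t : Finset (Fin R) // t.card = m} F :=
  fun s t => Matrix.det (Matrix.of fun i j : Fin m =>
    A (s.1.orderIsoOfFin s.2 i).1 (t.1.orderIsoOfFin t.2 j).1)

/-- Khatri–Rao (column-wise Kronecker) product. -/
def khatriRao {α β γ : Type*} (A : Matrix α γ F) (B : Matrix β γ F) : Matrix (α × β) γ F :=
  fun p c => A p.1 c * B p.2 c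

/-- A matrix has full column rank iff its columns are linearly independent. -/
def FullColRank {α γ : Type*} (M : Matrix α γ F) : Prop :=
  LinearIndependent F M.transpose

/-- The vector `d̂^(m)` of all products `d_{i₁} ⋯ d_{i_m}`, `i₁ < ⋯ < i_m`. -/
def hatVec {R : ℕ} (m : ℕ) (d : Fin R → F) : {t : Finset (Fin R) // t.card = m} → F :=
  fun t => ∏ i ∈ t.1, d i

/-- Condition (Um) for the pair `(A, B)`. -/
def CondU {I J R : ℕ} (m : ℕ) (A : Matrix (Fin I) (Fin R) F)
    (B : Matrix (Fin J) (Fin R) F) : Prop :=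
  ∀ d : Fin R → F,
    (khatriRao (compound m A) (compound m B)).mulVec (hatVec m d) = 0 → hatVec m d = 0

/-- Condition (Wm) for the triple `(A, B, C)`. -/
def CondW {I J K R : ℕ} (m : ℕ) (A : Matrix (Fin I) (Fin R) F)
    (B : Matrix (Fin J) (Fin R) F) (C : Matrix (Fin K) (Fin R) F) : Prop :=
  ∀ d : Fin R → F, (∃ x : Fin K → F, d = C.transpose.mulVec x) →
    (khatriRao (compound m A) (compound m B)).mulVec (hatVec m d) = 0 → hatVec m d = 0

/-- Condition (Hm) for the pair `(A, B)`: `H_{AB}(δ) ≥ min(δ, m)` for `δ = 1, …, R`. -/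
def CondH {I J R : ℕ} (m : ℕ) (A : Matrix (Fin I) (Fin R) F)
    (B : Matrix (Fin J) (Fin R) F) : Prop :=
  ∀ δ : ℕ, 1 ≤ δ → δ ≤ R → ∀ s : Finset (Fin R), s.card = δ →
    δ + min δ m ≤ (A.submatrix id (fun x : {y // y ∈ s} => x.1)).rank +
      (B.submatrix id (fun x : {y // y ∈ s} => x.1)).rank

section Kneser

set_option linter.unusedSectionVars false

variable {ι : Type*} [Fintype ι]

theorem avoid_subspaces {E κ : Type*} [AddCommGroup E] [Module F E] [Finite κ] (S : Submodule F E)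
    (W : κ → Submodule F E) (h : ∀ k, ∃ s ∈ S, s ∉ W k) : ∃ s ∈ S, ∀ k, s ∉ W k := by
  by_contra hcon
  push Not at hcon
  have : ⋃ k, (((W k).comap S.subtype : Submodule F S) : Set S) = Set.univ := by
    ext ⟨x, hx⟩
    simpa using hcon x hx
  obtain ⟨k, hk⟩ := Subspace.exists_eq_top_of_iUnion_eq_univ this
  obtain ⟨s, hs, hsk⟩ := h k
  have : (⟨s, hs⟩ : S) ∈ (W k).comap S.subtype := by rw [hk]; trivial
  exact hsk this

theorem exists_full_support (T : Submodule F (ι → F)) (h : ∀ i, ∃ t ∈ T, t i ≠ 0) :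
    ∃ t ∈ T, ∀ i, t i ≠ 0 :=
  avoid_subspaces T (fun i : ι => LinearMap.ker (LinearMap.proj (R := F) (φ := fun _ => F) i)) h

theorem finrank_map_mulLeft (t : ι → F) (ht : ∀ i, t i ≠ 0) (S : Submodule F (ι → F)) :
    Module.finrank F (S.map (LinearMap.mulLeft F t)) = Module.finrank F S := by
  have hinj : Function.Injective (LinearMap.mulLeft F t) := by
    intro x y hxy
    funext i
    have := congrFun hxy i
    simpa [ht i] using this
  exact (Submodule.equivMapOfInjective _ hinj S).finrank_eq.symm

/-- A subspace stable under a nonconstant multiplier is stable under a nontrivial idempotent. -/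
theorem exists_indicator (T : Submodule F (ι → F)) (s : ι → F) (i j : ι) (hij : s i ≠ s j)
    (h : ∀ t ∈ T, s * t ∈ T) :
    ∃ A : Set ι, A.Nonempty ∧ Aᶜ.Nonempty ∧ ∀ t ∈ T, A.indicator (1 : ι → F) * t ∈ T := by
  classical
  refine ⟨{k | s k = s i}, ⟨i, rfl⟩, ⟨j, fun hh => hij hh.symm⟩, ?_⟩
  let p : Polynomial F := Lagrange.interpolate (Finset.univ.image s) id
    (fun x => if x = s i then 1 else 0)
  have hp : ∀ q : Polynomial F, ∀ t ∈ T, (fun k => q.eval (s k)) * t ∈ T := by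
    intro q t ht
    induction q using Polynomial.induction_on' with
    | add p q hp hq =>
      have : (fun k => (p + q).eval (s k)) * t
        = (fun k => p.eval (s k)) * t + (fun k => q.eval (s k)) * t := by
        funext k; simp [add_mul]
      rw [this]; exact T.add_mem hp hq
    | monomial n a =>
      have h2 : s ^ n * t ∈ T := by
        induction n with
        | zero => simpa using ht
        | succ n ih => rw [pow_succ', mul_assoc]; exact h _ ih
      have : (fun k => ((Polynomial.monomial n) a).eval (s k)) * t = a • (s ^ n * t) := by
        funext k; simp [mul_assoc]
      rw [this]; exact T.smul_mem _ h2
  intro t ht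
  convert hp p t ht using 2
  funext k
  have := Lagrange.eval_interpolate_at_node (s := Finset.univ.image s) (v := id)
    (fun x => if x = s i then (1 : F) else 0) (Set.injOn_id _)
    (Finset.mem_image_of_mem s (Finset.mem_univ k))
  simp only [id] at this
  simp only [p]
  rw [show (id : F → F) = fun x => x from rfl] at *
  rw [this]
  simp [Set.indicator_apply]

theorem dyson (n : ℕ) : ∀ (S T : Submodule F (ι → F)), Module.finrank F S = n → 1 ∈ S →
    (∃ t ∈ T, ∀ i, t i ≠ 0) →
    ∃ V : Submodule F (ι → F), T ≤ V ∧ V ≤ S * T ∧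
      (Module.finrank F S + Module.finrank F T ≤ Module.finrank F V + 1 ∨
        ∃ A : Set ι, A.Nonempty ∧ Aᶜ.Nonempty ∧ ∀ v ∈ V, A.indicator (1 : ι → F) * v ∈ V) := by
  induction n using Nat.strong_induction_on with
  | _ n ih =>
  intro S T hn h1 hT
  have hTST : T ≤ S * T := fun t ht => by simpa using Submodule.mul_mem_mul h1 ht
  by_cases hex : ∃ t ∈ T, (∀ i, t i ≠ 0) ∧ ∃ s ∈ S, t * s ∉ T
  · obtain ⟨t, htT, ht0, s, hs, hts⟩ := hex
    set M := LinearMap.mulLeft F t with hM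
    let S' := S ⊓ T.comap M
    let T' := T ⊔ S.map M
    have hlt : S' < S := by
      refine lt_of_le_of_ne inf_le_left fun h => hts ?_
      have : s ∈ S' := h ▸ hs
      exact this.2
    have hrank : Module.finrank F S' + Module.finrank F T' =
        Module.finrank F S + Module.finrank F T := by
      have e : S'.map M = T ⊓ S.map M := by
        ext x
        constructor
        · rintro ⟨y, hy, rfl⟩
          exact ⟨hy.2, ⟨y, hy.1, rfl⟩⟩
        · rintro ⟨hx, ⟨y, hy, rfl⟩⟩
          exact ⟨y, ⟨hy, hx⟩, rfl⟩
      have e1 := finrank_map_mulLeft t ht0 S'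
      have e2 := finrank_map_mulLeft t ht0 S
      have e3 := Submodule.finrank_sup_add_finrank_inf_eq T (S.map M)
      rw [← hM] at e1 e2
      rw [e] at e1
      simp only [T']
      omega
    have hlt' := Submodule.finrank_lt_finrank_of_lt hlt
    obtain ⟨V, hV1, hV2, hV3⟩ := ih _ (hn ▸ hlt') S' T' rfl
      ⟨h1, by simpa [hM] using htT⟩ ⟨t, Submodule.mem_sup_left htT, ht0⟩
    refine ⟨V, le_sup_left.trans hV1, hV2.trans ?_, ?_⟩
    · rw [Submodule.mul_le]
      intro a ha b hb
      obtain ⟨b1, hb1, b2, ⟨c, hc, rfl⟩, rfl⟩ := Submodule.mem_sup.1 hb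
      rw [mul_add]
      refine Submodule.add_mem _ (Submodule.mul_mem_mul ha.1 hb1) ?_
      have h3 : t * a ∈ T := ha.2
      have : a * M c = c * (t * a) := by simp only [hM, LinearMap.mulLeft_apply]; ring
      rw [this]
      exact Submodule.mul_mem_mul hc h3
    · rw [← hrank]; exact hV3
  · push Not at hex
    refine ⟨T, le_rfl, hTST, ?_⟩
    by_cases hS : ∃ s ∈ S, ∃ i j, s i ≠ s j
    · right
      obtain ⟨s, hs, i, j, hij⟩ := hS
      refine exists_indicator T s i j hij fun t ht => ?_
      obtain ⟨t0, ht0, ht0'⟩ := hT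
      obtain ⟨l, hl⟩ := (Finset.univ.image (fun i => - t i / t0 i)).exists_notMem
      have hinv : ∀ i, (t + l • t0) i ≠ 0 := by
        intro i hi
        apply hl
        rw [Finset.mem_image]
        refine ⟨i, Finset.mem_univ _, ?_⟩
        rw [div_eq_iff (ht0' i)]
        simp only [Pi.add_apply, Pi.smul_apply, smul_eq_mul] at hi
        linear_combination -hi
      have e1 := hex _ (T.add_mem ht (T.smul_mem l ht0)) hinv s hs
      have e2 := T.smul_mem l (hex t0 ht0 ht0' s hs)
      have := T.sub_mem e1 e2
      convert this using 1
      funext i; simp; ring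
    · left
      push Not at hS
      have : Module.finrank F S ≤ 1 := by
        refine finrank_le_one (⟨1, h1⟩ : S) ?_
        rintro ⟨s, hs⟩
        by_cases hι : Nonempty ι
        · obtain ⟨i⟩ := hι
          refine ⟨s i, ?_⟩
          ext j
          simp [hS s hs i j]
        · refine ⟨0, ?_⟩
          ext j
          exact (hι ⟨j⟩).elim
      omega

theorem kneser (S T : Submodule F (ι → F)) (hS : ∀ i, ∃ t ∈ S, t i ≠ 0)
    (hT : ∀ i, ∃ t ∈ T, t i ≠ 0)
    (hns : ∀ A : Set ι, A.Nonempty → Aᶜ.Nonempty →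
      ¬ ∀ v ∈ S * T, A.indicator (1 : ι → F) * v ∈ S * T) :
    Module.finrank F S + Module.finrank F T ≤ Module.finrank F (S * T : Submodule F (ι → F)) + 1 := by
  classical
  by_contra hlt
  let W : {A : Set ι // A.Nonempty ∧ Aᶜ.Nonempty} → Submodule F (ι → F) := fun A =>
    ⨅ t : T, (S * T).comap (LinearMap.mulLeft F (A.1.indicator (1 : ι → F) * t.1))
  have hW : ∀ A s, s ∈ W A ↔ ∀ t ∈ T, A.1.indicator (1 : ι → F) * (s * t) ∈ S * T := by
    intro A s
    simp only [W, Submodule.mem_iInf, Submodule.mem_comap, LinearMap.mulLeft_apply, Subtype.forall]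
    refine forall₂_congr fun t _ => ?_
    rw [mul_assoc, mul_comm t s]
  obtain ⟨s, hs, hs2⟩ := avoid_subspaces S
    (Sum.elim W (fun i : ι => LinearMap.ker (LinearMap.proj (R := F) (φ := fun _ => F) i))) (by
      rintro (A | i)
      · by_contra hc
        push Not at hc
        refine hns A.1 A.2.1 A.2.2 fun v hv => ?_
        induction hv using Submodule.mul_induction_on' with
        | mem_mul_mem m hm n hn => exact (hW A m).1 (hc m hm) n hn
        | add x _ y _ hx hy => rw [mul_add]; exact Submodule.add_mem _ hx hy
      · exact hS i)
  have hs0 : ∀ i, s i ≠ 0 := fun i => hs2 (Sum.inr i)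
  have hsA : ∀ A, s ∉ W A := fun A => hs2 (Sum.inl A)
  have hsi : ∀ i, s⁻¹ i ≠ 0 := fun i => inv_ne_zero (hs0 i)
  have hss : s * s⁻¹ = 1 := by funext i; simp [hs0 i]
  obtain ⟨V, hV1, hV2, hV3⟩ := dyson _ (S.map (LinearMap.mulLeft F s⁻¹)) T rfl
    ⟨s, hs, by rw [LinearMap.mulLeft_apply, mul_comm, hss]⟩ (exists_full_support T hT)
  have hVST : ∀ v ∈ V, s * v ∈ S * T := by
    suffices hw : ∀ v ∈ S.map (LinearMap.mulLeft F s⁻¹) * T, s * v ∈ S * T from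
      fun v hv => hw v (hV2 hv)
    intro v hv
    induction hv using Submodule.mul_induction_on' with
    | mem_mul_mem m hm n hn =>
      obtain ⟨c, hc, rfl⟩ := hm
      have : s * (LinearMap.mulLeft F s⁻¹ c * n) = c * n := by
        rw [LinearMap.mulLeft_apply, ← mul_assoc, ← mul_assoc, hss, one_mul]
      rw [this]; exact Submodule.mul_mem_mul hc hn
    | add x _ y _ hx hy => rw [mul_add]; exact Submodule.add_mem _ hx hy
  rw [finrank_map_mulLeft _ hsi] at hV3
  rcases hV3 with h | ⟨A, hA1, hA2, hA⟩
  · have h1 := finrank_map_mulLeft s hs0 V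
    have h2 : V.map (LinearMap.mulLeft F s) ≤ S * T := by
      rintro _ ⟨v, hv, rfl⟩; exact hVST v hv
    have := Submodule.finrank_mono h2
    omega
  · apply hsA ⟨A, hA1, hA2⟩
    rw [hW]
    intro t ht
    rw [mul_left_comm]
    exact hVST _ (hA t (hV1 ht))

end Kneser

theorem krank_spec {I R : ℕ} (A : Matrix (Fin I) (Fin R) F) (s : Finset (Fin R))
    (hs : s.card ≤ krank A) :
    LinearIndependent F (fun r : {x // x ∈ s} => A.transpose r.1) := by
  have hmem : krank A ∈ {k | k ≤ R ∧ ∀ s : Finset (Fin R), s.card = k →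
      LinearIndependent F (fun r : {x // x ∈ s} => A.transpose r.1)} := by
    refine Nat.sSup_mem ⟨0, Nat.zero_le _, ?_⟩ ⟨R, fun k hk => hk.1⟩
    intro s hs
    rw [Finset.card_eq_zero] at hs
    subst hs
    exact linearIndependent_empty_type
  obtain ⟨h1, h2⟩ := hmem
  obtain ⟨t, hst, -, ht⟩ := Finset.exists_subsuperset_card_eq (Finset.subset_univ s) hs
    (by simpa using h1)
  exact (h2 t ht).comp (fun r : {x // x ∈ s} => (⟨r.1, hst r.2⟩ : {x // x ∈ t}))
    (fun a b hab => Subtype.ext (congrArg (fun z : {x // x ∈ t} => z.1) hab))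

theorem rank_spec {I R : ℕ} (A : Matrix (Fin I) (Fin R) F) :
    ∃ s : Finset (Fin R), s.card = A.rank ∧
      LinearIndependent F (fun r : {x // x ∈ s} => A.transpose r.1) := by
  classical
  obtain ⟨κ, a, ha, hspan, hli⟩ := exists_linearIndependent' F (A.transpose : Fin R → Fin I → F)
  have : Finite κ := Finite.of_injective a ha
  have := Fintype.ofFinite κ
  refine ⟨Finset.univ.image a, ?_, ?_⟩
  · rw [Finset.card_image_of_injective _ ha, Matrix.rank_eq_finrank_span_cols]
    have := finrank_span_eq_card hli
    rw [hspan] at this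
    rw [Finset.card_univ]
    exact this.symm
  · have h := fun r : {x // x ∈ Finset.univ.image a} => Finset.mem_image.1 r.2
    choose f hf using h
    have e : (fun r : {x // x ∈ Finset.univ.image a} => A.transpose r.1)
        = (A.transpose ∘ a) ∘ f := by
      funext r
      show A.transpose r.1 = A.transpose (a (f r))
      rw [(hf r).2]
    rw [e]
    refine hli.comp f fun x y hxy => Subtype.ext ?_
    rw [← (hf x).2, ← (hf y).2, hxy]

/-- Row space of the matrix with columns `u a`, `a ∈ X`. -/
def rowSpan {N : Type*} {I : ℕ} (u : N → Fin I → F) (X : Finset N) : Submodule F (X → F) :=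
  Submodule.span F (Set.range fun i => fun a : X => u a.1 i)

theorem card_le_rowSpan {N : Type*} {I : ℕ} (u : N → Fin I → F) (X : Finset N)
    {κ : Type*} [Fintype κ] (g : κ → X) (h : LinearIndependent F (fun k => u (g k).1)) :
    Fintype.card κ ≤ Module.finrank F (rowSpan u X) := by
  let M : Matrix (Fin I) X F := Matrix.of fun i a => u a.1 i
  have e : rowSpan u X = Submodule.span F (Set.range M.row) := rfl
  rw [e, ← Matrix.rank_eq_finrank_span_row, Matrix.rank_eq_finrank_span_cols,
    ← finrank_span_eq_card h]
  apply Submodule.finrank_mono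
  apply Submodule.span_mono
  rintro _ ⟨k, rfl⟩
  exact ⟨g k, rfl⟩

theorem rowSpan_full {N : Type*} {I : ℕ} (u : N → Fin I → F) (X : Finset N)
    (hu : ∀ a, u a ≠ 0) (a : X) : ∃ t ∈ rowSpan u X, t a ≠ 0 := by
  obtain ⟨i, hi⟩ := Function.ne_iff.1 (hu a.1)
  exact ⟨_, Submodule.subset_span ⟨i, rfl⟩, hi⟩

def ZeroSum {N : Type*} {I J K : ℕ} (e : N → F) (u : N → Fin I → F) (v : N → Fin J → F)
    (w : N → Fin K → F) (X : Finset N) : Prop :=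
  ∀ i j k, ∑ a ∈ X, e a * (u a i * v a j * w a k) = 0

theorem nonsplit {N : Type*} [DecidableEq N] {I J K : ℕ} (e : N → F) (u : N → Fin I → F)
    (v : N → Fin J → F) (w : N → Fin K → F) (he : ∀ a, e a ≠ 0) (hu : ∀ a, u a ≠ 0)
    (hv : ∀ a, v a ≠ 0) (hw : ∀ a, w a ≠ 0) (X : Finset N) (hX : X.Nonempty)
    (hz : ZeroSum e u v w X)
    (hns : ∀ Y ⊆ X, Y.Nonempty → (X \ Y).Nonempty → ¬ ZeroSum e u v w Y) :
    Module.finrank F (rowSpan u X) + Module.finrank F (rowSpan v X)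
      + Module.finrank F (rowSpan w X) ≤ X.card + 1 := by
  classical
  set U := rowSpan u X with hU
  set V := rowSpan v X with hV
  set W := rowSpan w X with hW
  let φ : (X → F) →ₗ[F] F := ∑ a : X, e a.1 • LinearMap.proj (R := F) (φ := fun _ => F) a
  have hφ : ∀ x, φ x = ∑ a : X, e a.1 * x a := by intro x; simp [φ]
  have hker : U * V * W ≤ LinearMap.ker φ := by
    rw [hU, hV, hW, rowSpan, rowSpan, rowSpan, Submodule.span_mul_span, Submodule.span_mul_span,
      Submodule.span_le]
    rintro _ ⟨_, ⟨_, ⟨i, rfl⟩, _, ⟨j, rfl⟩, rfl⟩, _, ⟨k, rfl⟩, rfl⟩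
    simp only [SetLike.mem_coe, LinearMap.mem_ker]
    rw [hφ, ← hz i j k, ← Finset.sum_coe_sort X]
    rfl
  have hlt : Module.finrank F (U * V * W : Submodule F (X → F)) < X.card := by
    have h1 : U * V * W ≠ ⊤ := by
      intro htop
      rw [htop] at hker
      obtain ⟨a, ha⟩ := hX
      have : Pi.single (⟨a, ha⟩ : X) (1 : F) ∈ LinearMap.ker φ := hker trivial
      rw [LinearMap.mem_ker, hφ] at this
      simp [Pi.single_apply, he a] at this
    have := Submodule.finrank_lt h1
    simpa using this
  have hst : ∀ A : Set X, A.Nonempty → Aᶜ.Nonempty →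
      ¬ ∀ z ∈ U * V * W, A.indicator (1 : X → F) * z ∈ U * V * W := by
    rintro A ⟨a, ha⟩ ⟨b, hb⟩ hA
    refine hns ((Finset.univ.filter (· ∈ A)).map (Function.Embedding.subtype _)) ?_ ?_ ?_ ?_
    · intro x hx
      simp only [Finset.mem_map, Function.Embedding.subtype_apply] at hx
      obtain ⟨y, -, rfl⟩ := hx
      exact y.2
    · exact ⟨a.1, by simpa using ha⟩
    · exact ⟨b.1, by simpa using hb⟩
    · intro i j k
      have hm : (fun a : X => u a.1 i) * (fun a : X => v a.1 j) * (fun a : X => w a.1 k)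
          ∈ U * V * W := Submodule.mul_mem_mul (Submodule.mul_mem_mul
          (Submodule.subset_span ⟨i, rfl⟩) (Submodule.subset_span ⟨j, rfl⟩))
          (Submodule.subset_span ⟨k, rfl⟩)
      have := hker (hA _ hm)
      rw [LinearMap.mem_ker, hφ] at this
      rw [Finset.sum_map, Finset.sum_filter]
      refine Eq.trans ?_ this
      refine Finset.sum_congr rfl fun a _ => ?_
      by_cases h : a ∈ A <;> simp [h]
  have k1 := kneser (U * V) W (by
    intro a
    obtain ⟨s, hs, hs'⟩ := rowSpan_full u X hu a
    obtain ⟨t, ht, ht'⟩ := rowSpan_full v X hv a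
    exact ⟨s * t, Submodule.mul_mem_mul hs ht, mul_ne_zero hs' ht'⟩) (rowSpan_full w X hw) hst
  have k2 := kneser U V (rowSpan_full u X hu) (rowSpan_full v X hv) (by
    intro A h1 h2 h3
    refine hst A h1 h2 fun z hz => ?_
    induction hz using Submodule.mul_induction_on' with
    | mem_mul_mem m hm n hn =>
      rw [← mul_assoc]; exact Submodule.mul_mem_mul (h3 m hm) hn
    | add x _ y _ hx hy => rw [mul_add]; exact Submodule.add_mem _ hx hy)
  omega

theorem rowSpan_bounds {I R R' : ℕ} (A : Matrix (Fin I) (Fin R) F) (A' : Matrix (Fin I) (Fin R') F)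
    (X : Finset (Fin R ⊕ Fin R')) :
    min (krank A) X.toLeft.card ≤ Module.finrank F (rowSpan (Sum.elim A.transpose A'.transpose) X) ∧
    A.rank + X.toLeft.card ≤
      Module.finrank F (rowSpan (Sum.elim A.transpose A'.transpose) X) + R := by
  classical
  have key : ∀ s ⊆ X.toLeft, LinearIndependent F (fun r : {x // x ∈ s} => A.transpose r.1) →
      s.card ≤ Module.finrank F (rowSpan (Sum.elim A.transpose A'.transpose) X) := by
    intro s hs hli
    have := card_le_rowSpan (Sum.elim A.transpose A'.transpose) X
      (fun r : {x // x ∈ s} => (⟨Sum.inl r.1, Finset.mem_toLeft.1 (hs r.2)⟩ : X)) hli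
    simpa using this
  constructor
  · obtain ⟨s, hs, hc⟩ := Finset.exists_subset_card_eq (min_le_right (krank A) X.toLeft.card)
    rw [← hc]
    exact key s hs (krank_spec A s (hc ▸ min_le_left _ _))
  · obtain ⟨s, hc, hli⟩ := rank_spec A
    have h1 := key (s ∩ X.toLeft) Finset.inter_subset_right
      (hli.comp (fun r : {x // x ∈ s ∩ X.toLeft} =>
        (⟨r.1, (Finset.mem_inter.1 r.2).1⟩ : {x // x ∈ s}))
      (fun a b hab => Subtype.ext (congrArg (fun z : {x // x ∈ s} => z.1) hab)))
    have h2 := Finset.card_union_add_card_inter s X.toLeft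
    have h3 := Finset.card_le_univ (s ∪ X.toLeft)
    rw [Fintype.card_fin] at h3
    omega

theorem core {I J K R R' : ℕ}
    (A : Matrix (Fin I) (Fin R) F) (B : Matrix (Fin J) (Fin R) F) (C : Matrix (Fin K) (Fin R) F)
    (A' : Matrix (Fin I) (Fin R') F) (B' : Matrix (Fin J) (Fin R') F)
    (C' : Matrix (Fin K) (Fin R') F)
    (hA : ∀ r, A.transpose r ≠ 0) (hB : ∀ r, B.transpose r ≠ 0) (hC : ∀ r, C.transpose r ≠ 0)
    (hA' : ∀ r, A'.transpose r ≠ 0) (hB' : ∀ r, B'.transpose r ≠ 0)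
    (hC' : ∀ r, C'.transpose r ≠ 0)
    (h1 : krank A + B.rank + C.rank ≥ 2 * R + 2)
    (h2 : A.rank + krank B + C.rank ≥ 2 * R + 2)
    (h3 : A.rank + B.rank + krank C ≥ 2 * R + 2) (n : ℕ) :
    ∀ X : Finset (Fin R ⊕ Fin R'), X.card = n →
    ZeroSum (Sum.elim (fun _ => (1 : F)) (fun _ => -1)) (Sum.elim A.transpose A'.transpose)
      (Sum.elim B.transpose B'.transpose) (Sum.elim C.transpose C'.transpose) X →
    X.toLeft.card ≤ X.toRight.card ∧ (X.toRight.card ≤ X.toLeft.card →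
      ∀ a ∈ X.toLeft, ∃ b ∈ X.toRight, ∀ i j k,
        A i a * B j a * C k a = A' i b * B' j b * C' k b) := by
  classical
  induction n using Nat.strong_induction_on with
  | _ n ih =>
  intro X hn hz
  have hcard := Finset.card_toLeft_add_card_toRight (u := X)
  by_cases hsp : ∃ Y ⊆ X, Y.Nonempty ∧ (X \ Y).Nonempty ∧
    ZeroSum (Sum.elim (fun _ => (1 : F)) (fun _ => -1)) (Sum.elim A.transpose A'.transpose)
      (Sum.elim B.transpose B'.transpose) (Sum.elim C.transpose C'.transpose) Y
  · obtain ⟨Y, hYX, hY1, hY2, hYz⟩ := hsp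
    have hc := Finset.card_sdiff_add_card_eq_card hYX
    have hp1 := hY1.card_pos
    have hp2 := hY2.card_pos
    obtain ⟨a1, a2⟩ := ih Y.card (by omega) Y rfl hYz
    obtain ⟨b1, b2⟩ := ih (X \ Y).card (by omega) (X \ Y) rfl (by
      intro i j k
      have := Finset.sum_sdiff hYX (f := fun a =>
        (Sum.elim (fun _ => (1 : F)) (fun _ => -1) : Fin R ⊕ Fin R' → F) a *
        ((Sum.elim A.transpose A'.transpose : Fin R ⊕ Fin R' → _) a i *
        (Sum.elim B.transpose B'.transpose : Fin R ⊕ Fin R' → _) a j *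
        (Sum.elim C.transpose C'.transpose : Fin R ⊕ Fin R' → _) a k))
      rw [hz i j k, hYz i j k, add_zero] at this
      exact this)
    have hl : (X \ Y).toLeft = X.toLeft \ Y.toLeft := by ext; simp
    have hr : (X \ Y).toRight = X.toRight \ Y.toRight := by ext; simp
    have hl' : Y.toLeft ⊆ X.toLeft := by intro x; simpa using fun h => hYX h
    have hr' : Y.toRight ⊆ X.toRight := by intro x; simpa using fun h => hYX h
    have hlc := Finset.card_sdiff_add_card_eq_card hl'
    have hrc := Finset.card_sdiff_add_card_eq_card hr'
    rw [← hl] at hlc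
    rw [← hr] at hrc
    refine ⟨by omega, fun hle a ha => ?_⟩
    by_cases haY : a ∈ Y.toLeft
    · obtain ⟨b, hb, hb'⟩ := a2 (by omega) a haY
      exact ⟨b, hr' hb, hb'⟩
    · obtain ⟨b, hb, hb'⟩ := b2 (by omega) a (by rw [hl]; simp_all)
      rw [hr] at hb
      exact ⟨b, (Finset.mem_sdiff.1 hb).1, hb'⟩
  · push Not at hsp
    rcases Nat.lt_or_ge X.toLeft.card 2 with hlt | hge
    · rcases Nat.lt_or_ge X.toLeft.card 1 with h0 | h1'
      · refine ⟨by omega, fun _ a ha => ?_⟩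
        have : 0 < X.toLeft.card := Finset.card_pos.2 ⟨a, ha⟩
        omega
      · obtain ⟨a, ha⟩ := Finset.card_eq_one.1 (show X.toLeft.card = 1 by omega)
        have hz' : ∀ i j k, A i a * B j a * C k a =
            ∑ b ∈ X.toRight, A' i b * B' j b * C' k b := by
          intro i j k
          have := hz i j k
          rw [← Finset.toLeft_disjSum_toRight (u := X), Finset.sum_disjSum, ha] at this
          simp at this
          change A i a * B j a * C k a + -∑ b ∈ X.toRight, A' i b * B' j b * C' k b = 0 at this
          linear_combination this
        have hpos : X.toRight.card ≠ 0 := by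
          intro h0
          rw [Finset.card_eq_zero] at h0
          obtain ⟨i, hi⟩ := Function.ne_iff.1 (hA a)
          obtain ⟨j, hj⟩ := Function.ne_iff.1 (hB a)
          obtain ⟨k, hk⟩ := Function.ne_iff.1 (hC a)
          have := hz' i j k
          rw [h0, Finset.sum_empty] at this
          exact mul_ne_zero (mul_ne_zero hi hj) hk this
        refine ⟨by omega, fun hle a' ha' => ?_⟩
        rw [ha, Finset.mem_singleton] at ha'
        subst ha'
        obtain ⟨b, hb⟩ := Finset.card_eq_one.1 (show X.toRight.card = 1 by omega)
        refine ⟨b, by simp [hb], fun i j k => ?_⟩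
        rw [hz', hb, Finset.sum_singleton]
    · have hXne : X.Nonempty := Finset.card_pos.1 (by omega)
      have hb := nonsplit _ _ _ _ (by rintro (a | a) <;> simp)
        (by rintro (a | a); exacts [hA a, hA' a])
        (by rintro (a | a); exacts [hB a, hB' a])
        (by rintro (a | a); exacts [hC a, hC' a]) X hXne hz hsp
      have bA := rowSpan_bounds A A' X
      have bB := rowSpan_bounds B B' X
      have bC := rowSpan_bounds C C' X
      have rA := A.rank_le_width
      have rB := B.rank_le_width
      have rC := C.rank_le_width
      have : X.toLeft.card + 1 ≤ X.toRight.card := by omega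
      exact ⟨by omega, fun h => by omega⟩

theorem rank_one_eq {I J K : ℕ} (a a' : Fin I → F) (b b' : Fin J → F) (c c' : Fin K → F)
    (ha : a' ≠ 0) (hb : b' ≠ 0) (hc : c' ≠ 0)
    (h : ∀ i j k, a i * b j * c k = a' i * b' j * c' k) :
    ∃ la lb lc : F, la * lb * lc = 1 ∧ (∀ i, a' i = a i * la) ∧ (∀ j, b' j = b j * lb) ∧
      (∀ k, c' k = c k * lc) := by
  obtain ⟨i, hi⟩ := Function.ne_iff.1 ha
  obtain ⟨j, hj⟩ := Function.ne_iff.1 hb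
  obtain ⟨k, hk⟩ := Function.ne_iff.1 hc
  simp only [Pi.zero_apply] at hi hj hk
  have h0 := h i j k
  have hne : a i * b j * c k ≠ 0 := by rw [h0]; exact mul_ne_zero (mul_ne_zero hi hj) hk
  have hai : a i ≠ 0 := fun hh => hne (by simp [hh])
  have hbj : b j ≠ 0 := fun hh => hne (by simp [hh])
  have hck : c k ≠ 0 := fun hh => hne (by simp [hh])
  refine ⟨b j * c k / (b' j * c' k), a i * c k / (a' i * c' k), a i * b j / (a' i * b' j),
    ?_, ?_, ?_, ?_⟩
  · have : b j * c k / (b' j * c' k) * (a i * c k / (a' i * c' k)) * (a i * b j / (a' i * b' j))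
        = (a i * b j * c k / (a' i * b' j * c' k)) ^ 2 := by
      field_simp
    rw [this, h0, div_self (mul_ne_zero (mul_ne_zero hi hj) hk), one_pow]
  · intro x
    have := h x j k
    field_simp
    linear_combination -this
  · intro x
    have := h i x k
    field_simp
    linear_combination -this
  · intro x
    have := h i j x
    field_simp
    linear_combination -this

theorem main_match {I J K R R' : ℕ} (T : Fin I → Fin J → Fin K → F)
    (A : Matrix (Fin I) (Fin R) F) (B : Matrix (Fin J) (Fin R) F) (C : Matrix (Fin K) (Fin R) F)
    (A' : Matrix (Fin I) (Fin R') F) (B' : Matrix (Fin J) (Fin R') F)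
    (C' : Matrix (Fin K) (Fin R') F)
    (hPD : IsPD T A B C) (hPD' : IsPD T A' B' C')
    (h1 : krank A + B.rank + C.rank ≥ 2 * R + 2)
    (h2 : A.rank + krank B + C.rank ≥ 2 * R + 2)
    (h3 : A.rank + B.rank + krank C ≥ 2 * R + 2) :
    R ≤ R' ∧ (R' ≤ R → ∀ a, ∃ b, ∀ i j k,
        A i a * B j a * C k a = A' i b * B' j b * C' k b) := by
  obtain ⟨hA, hB, hC, hT⟩ := hPD
  obtain ⟨hA', hB', hC', hT'⟩ := hPD'
  have := core A B C A' B' C' hA hB hC hA' hB' hC' h1 h2 h3 _ Finset.univ rfl (by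
    intro i j k
    rw [Fintype.sum_sum_type]
    have := congrFun (congrFun (congrFun (hT.symm.trans hT') i) j) k
    simp only [pdTensor] at this
    simp
    change ∑ r, A i r * B j r * C k r + -∑ r, A' i r * B' j r * C' k r = 0
    rw [this, add_neg_cancel])
  have hl : (Finset.univ : Finset (Fin R ⊕ Fin R')).toLeft = Finset.univ := by ext; simp
  have hr : (Finset.univ : Finset (Fin R ⊕ Fin R')).toRight = Finset.univ := by ext; simp
  rw [hl, hr] at this
  simpa using this

theorem main_unique {I J K R : ℕ} (T : Fin I → Fin J → Fin K → F)
    (A A' : Matrix (Fin I) (Fin R) F) (B B' : Matrix (Fin J) (Fin R) F)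
    (C C' : Matrix (Fin K) (Fin R) F)
    (hPD : IsPD T A B C) (hPD' : IsPD T A' B' C')
    (h1 : krank A + B.rank + C.rank ≥ 2 * R + 2)
    (h2 : A.rank + krank B + C.rank ≥ 2 * R + 2)
    (h3 : A.rank + B.rank + krank C ≥ 2 * R + 2) :
    ∃ σ : Equiv.Perm (Fin R), ∃ la lb lc : Fin R → F,
      (∀ r, la r * lb r * lc r = 1) ∧
      (∀ i r, A' i r = A i (σ r) * la r) ∧
      (∀ j r, B' j r = B j (σ r) * lb r) ∧
      (∀ k r, C' k r = C k (σ r) * lc r) := by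
  classical
  have hm := (main_match T A B C A' B' C' hPD hPD' h1 h2 h3).2 le_rfl
  choose g hg using hm
  have hs := fun a => rank_one_eq (A.transpose a) (A'.transpose (g a)) (B.transpose a)
    (B'.transpose (g a)) (C.transpose a) (C'.transpose (g a)) (hPD'.1 _) (hPD'.2.1 _)
    (hPD'.2.2.1 _) (hg a)
  choose la lb lc hl hla hlb hlc using hs
  have hinj : Function.Injective g := by
    intro a b hab
    by_contra hne
    have rB := B.rank_le_width
    have rC := C.rank_le_width
    have hli := krank_spec A {a, b} (by rw [Finset.card_pair hne]; omega)
    have hla0 : la a ≠ 0 := fun h0 => by have := hl a; simp [h0] at this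
    have ha : a ∈ ({a, b} : Finset (Fin R)) := by simp
    have hb : b ∈ ({a, b} : Finset (Fin R)) := by simp
    have hp := hli.comp ![(⟨a, ha⟩ : {x // x ∈ ({a, b} : Finset (Fin R))}), ⟨b, hb⟩] (by
      intro x y
      fin_cases x <;> fin_cases y <;> simp [hne, Ne.symm hne])
    have := (LinearIndependent.pair_iff (R := F) (x := A.transpose a) (y := A.transpose b)).1 (by
      have hfun : ![A.transpose a, A.transpose b] =
          (fun r : {x // x ∈ ({a, b} : Finset (Fin R))} => A.transpose r.1) ∘
            ![(⟨a, ha⟩ : {x // x ∈ ({a, b} : Finset (Fin R))}), ⟨b, hb⟩] := by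
        funext x
        fin_cases x <;> rfl
      rw [hfun]
      exact hp) (la a) (-(la b)) (by
        funext i
        have e1 := hla a i
        have e2 := hla b i
        rw [hab] at e1
        simp only [Pi.add_apply, Pi.smul_apply, smul_eq_mul, Pi.zero_apply]
        linear_combination e2 - e1)
    exact hla0 this.1
  let e := Equiv.ofBijective g (Finite.injective_iff_bijective.1 hinj)
  have he : ∀ r, g (e.symm r) = r := fun r => e.apply_symm_apply r
  refine ⟨e.symm, la ∘ e.symm, lb ∘ e.symm, lc ∘ e.symm, fun r => hl _, ?_, ?_, ?_⟩
  · intro i r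
    have := hla (e.symm r) i
    rw [he] at this
    exact this
  · intro i r
    have := hlb (e.symm r) i
    rw [he] at this
    exact this
  · intro i r
    have := hlc (e.symm r) i
    rw [he] at this
    exact this

/-- Corollary 1.21: relaxed Kruskal-type uniqueness condition. -/
theorem stmt_10 {I J K R : ℕ} (T : Fin I → Fin J → Fin K → F)
    (A : Matrix (Fin I) (Fin R) F) (B : Matrix (Fin J) (Fin R) F) (C : Matrix (Fin K) (Fin R) F)
    (hPD : IsPD T A B C)
    (h1 : krank A + B.rank + C.rank ≥ 2 * R + 2)
    (h2 : A.rank + krank B + C.rank ≥ 2 * R + 2)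
    (h3 : A.rank + B.rank + krank C ≥ 2 * R + 2) :
    tensorRank T = R ∧ CPDUnique T R := by
  refine ⟨le_antisymm (Nat.sInf_le ⟨A, B, C, hPD⟩) ?_, ?_⟩
  · refine le_csInf ⟨R, A, B, C, hPD⟩ ?_
    rintro R' ⟨A', B', C', hPD'⟩
    exact (main_match T A B C A' B' C' hPD hPD' h1 h2 h3).1
  · intro A1 A2 B1 B2 C1 C2 hp1 hp2
    obtain ⟨σ, a, b, c, h, ha, hb, hc⟩ := main_unique T A A1 B B1 C C1 hPD hp1 h1 h2 h3
    obtain ⟨τ, a', b', c', h', ha', hb', hc'⟩ := main_unique T A A2 B B2 C C2 hPD hp2 h1 h2 h3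
    have na : ∀ r, a r ≠ 0 := fun r h0 => by have := h r; simp [h0] at this
    have nb : ∀ r, b r ≠ 0 := fun r h0 => by have := h r; simp [h0] at this
    have nc : ∀ r, c r ≠ 0 := fun r h0 => by have := h r; simp [h0] at this
    refine ⟨τ.trans σ.symm, fun r => a' r / a (σ.symm (τ r)), fun r => b' r / b (σ.symm (τ r)),
      fun r => c' r / c (σ.symm (τ r)), ?_, ?_, ?_, ?_⟩
    · intro r
      rw [div_mul_div_comm, div_mul_div_comm, h, h', div_one]
    · intro i r
      have := na (σ.symm (τ r))
      rw [ha, ha']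
      simp only [Equiv.trans_apply, Equiv.apply_symm_apply]
      field_simp
    · intro i r
      have := nb (σ.symm (τ r))
      rw [hb, hb']
      simp only [Equiv.trans_apply, Equiv.apply_symm_apply]
      field_simp
    · intro i r
      have := nc (σ.symm (τ r))
      rw [hc, hc']
      simp only [Equiv.trans_apply, Equiv.apply_symm_apply]
      field_simp
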